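/- Let p ∈ ℕ* and φ, φ̃, ψ, ψ̃ ∈ C^∞(ℝᵖ,ℝᵖ). If φ ≡₁ 0, φ ≡₃ φ̃ and ψ ≡₂ ψ̃, then [φ,ψ] ≡₂ [φ̃,ψ̃]. -/

import Mathlib

noncomputable section

/-- `ℝᵖ` with its Euclidean structure. -/
abbrev Euc (p : ℕ) := EuclideanSpace ℝ (Fin p)

/-- The Lie bracket of vector fields: `[X,Y](x) := Y'(x)·X(x) − X'(x)·Y(x)`. -/
def lieB {p : ℕ} (X Y : Euc p → Euc p) : Euc p → Euc p :=
  fun x => fderiv ℝ Y x (X x) - fderiv ℝ X x (Y x)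

/-- `φ ≡ₘ ψ` (equality modulo `m`-th order terms): there exists a smooth map `θ`
from `ℝᵖ` to the space of symmetric `m`-multilinear maps `(ℝᵖ)ᵐ → ℝᵖ` such that
`φ(x) = ψ(x) + θ(x)[x,…,x]` for all `x`. -/
def EqMod {p : ℕ} (m : ℕ) (φ ψ : Euc p → Euc p) : Prop :=
  ∃ θ : Euc p → ContinuousMultilinearMap ℝ (fun _ : Fin m => Euc p) (Euc p),
    ContDiff ℝ (⊤ : ℕ∞) θ ∧
    (∀ x : Euc p, ∀ v : Fin m → Euc p, ∀ σ : Equiv.Perm (Fin m),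
      θ x (v ∘ σ) = θ x v) ∧
    ∀ x : Euc p, φ x = ψ x + θ x (fun _ => x)

section VanishesToOrder

variable {E : Type} [NormedAddCommGroup E] [NormedSpace ℝ E]

/-- `f` is a smooth map which can be written as `f x = g x x ⋯ x`, where `g` is a smooth map
with values in the `k`-fold iterated spaces of continuous linear maps. -/
def VanishesToOrder : ℕ → ∀ {F : Type} [NormedAddCommGroup F] [NormedSpace ℝ F], (E → F) → Prop
  | 0, _, _, _, f => ContDiff ℝ (⊤ : ℕ∞) f
  | k + 1, F, _, _, f => ∃ g : E → E →L[ℝ] F, VanishesToOrder k g ∧ ∀ x, f x = g x x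

variable {F G H : Type} [NormedAddCommGroup F] [NormedSpace ℝ F]
  [NormedAddCommGroup G] [NormedSpace ℝ G] [NormedAddCommGroup H] [NormedSpace ℝ H]

theorem VanishesToOrder.add {k : ℕ} {f g : E → F} (hf : VanishesToOrder k f)
    (hg : VanishesToOrder k g) : VanishesToOrder k (fun x => f x + g x) := by
  induction k generalizing F with
  | zero => exact ContDiff.add hf hg
  | succ k ih =>
    obtain ⟨f', hf', hff'⟩ := hf
    obtain ⟨g', hg', hgg'⟩ := hg
    exact ⟨fun x => f' x + g' x, ih hf' hg', fun x => by simp [hff', hgg']⟩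

theorem VanishesToOrder.clm_comp {k : ℕ} {f : E → F} (L : F →L[ℝ] G)
    (hf : VanishesToOrder k f) : VanishesToOrder k (fun x => L (f x)) := by
  induction k generalizing F G with
  | zero => exact L.contDiff.comp hf
  | succ k ih =>
    obtain ⟨f', hf', hff'⟩ := hf
    exact ⟨fun x => L.comp (f' x), ih (ContinuousLinearMap.compL ℝ E F G L) hf',
      fun x => by simp [hff']⟩

theorem VanishesToOrder.sub {k : ℕ} {f g : E → F} (hf : VanishesToOrder k f)
    (hg : VanishesToOrder k g) : VanishesToOrder k (fun x => f x - g x) := by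
  simpa [sub_eq_add_neg] using hf.add (hg.clm_comp (-ContinuousLinearMap.id ℝ F))

theorem VanishesToOrder.bilin {k l : ℕ} {f : E → F} {g : E → G} (B : F →L[ℝ] G →L[ℝ] H)
    (hf : VanishesToOrder k f) (hg : VanishesToOrder l g) :
    VanishesToOrder (k + l) (fun x => B (f x) (g x)) := by
  induction l generalizing G H with
  | zero =>
    induction k generalizing F H with
    | zero => exact (B.contDiff.comp hf).clm_apply hg
    | succ k ih =>
      obtain ⟨f', hf', hff'⟩ := hf
      exact ⟨fun x => (B.flip (g x)).comp (f' x),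
        ih (B := ((ContinuousLinearMap.compL ℝ E F H).comp B.flip).flip) hf',
        fun x => by simp [hff']⟩
  | succ l ih =>
    obtain ⟨g', hg', hgg'⟩ := hg
    exact ⟨fun x => (B (f x)).comp (g' x),
      ih ((ContinuousLinearMap.compL ℝ E G H).comp B) hg', fun x => by simp [hgg']⟩

theorem VanishesToOrder.clm_apply {k l : ℕ} {f : E → F →L[ℝ] G} {g : E → F}
    (hf : VanishesToOrder k f) (hg : VanishesToOrder l g) :
    VanishesToOrder (k + l) (fun x => f x (g x)) :=
  hf.bilin (ContinuousLinearMap.id ℝ (F →L[ℝ] G)) hg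

theorem vanishesToOrder_zero {f : E → F} :
    VanishesToOrder 0 f ↔ ContDiff ℝ (⊤ : ℕ∞) f := Iff.rfl

theorem VanishesToOrder.of_succ {k : ℕ} {f : E → F} (hf : VanishesToOrder (k + 1) f) :
    VanishesToOrder k f := by
  obtain ⟨g, hg, hfg⟩ := hf
  rw [funext hfg]
  exact hg.clm_apply (vanishesToOrder_zero.2 contDiff_id)

theorem VanishesToOrder.contDiff {k : ℕ} {f : E → F} (hf : VanishesToOrder k f) :
    ContDiff ℝ (⊤ : ℕ∞) f := by
  induction k with
  | zero => exact hf
  | succ k ih => exact ih hf.of_succ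

theorem ContDiff.contDiff_fderiv_infty {f : E → F} (hf : ContDiff ℝ (⊤ : ℕ∞) f) :
    ContDiff ℝ (⊤ : ℕ∞) (fderiv ℝ f) :=
  hf.fderiv_right (by norm_cast)

theorem VanishesToOrder.fderiv {k : ℕ} {f : E → F} (hf : VanishesToOrder (k + 1) f) :
    VanishesToOrder k (fderiv ℝ f) := by
  induction k generalizing F with
  | zero => exact hf.contDiff.contDiff_fderiv_infty
  | succ k ih =>
    obtain ⟨g, hg, hfg⟩ := hf
    have hd : ∀ x, _root_.fderiv ℝ f x = (_root_.fderiv ℝ g x).flip x + g x := by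
      intro x
      have hgx : DifferentiableAt ℝ g x := hg.contDiff.differentiable (by simp) x
      rw [funext hfg, fderiv_clm_apply hgx differentiableAt_fun_id]
      ext v
      simp [add_comm]
    rw [funext hd]
    refine VanishesToOrder.add ?_ hg
    exact ⟨fun x => (_root_.fderiv ℝ g x).flip,
      (ih hg).clm_comp (G := E →L[ℝ] E →L[ℝ] F)
        (ContinuousLinearMap.flipₗᵢ ℝ E E F : _ →L[ℝ] _),
      fun x => rfl⟩

theorem vanishesToOrder_iff_exists_multilinear {m : ℕ} {f : E → F} :
    VanishesToOrder m f ↔ ∃ θ : E → ContinuousMultilinearMap ℝ (fun _ : Fin m => E) F,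
      ContDiff ℝ (⊤ : ℕ∞) θ ∧ ∀ x, f x = θ x (fun _ => x) := by
  induction m generalizing F with
  | zero =>
    refine ⟨fun hf => ⟨fun x => (continuousMultilinearCurryFin0 ℝ E F).symm (f x),
      (continuousMultilinearCurryFin0 ℝ E F).symm.contDiff.comp hf, fun x => by simp⟩, ?_⟩
    rintro ⟨θ, hθ, hfθ⟩
    have hf : f = fun x => continuousMultilinearCurryFin0 ℝ E F (θ x) := by
      ext x
      rw [hfθ, continuousMultilinearCurryFin0_apply]
      congr 1
      exact Subsingleton.elim _ _
    rw [hf]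
    exact (continuousMultilinearCurryFin0 ℝ E F).contDiff.comp hθ
  | succ m ih =>
    constructor
    · rintro ⟨g, hg, hfg⟩
      obtain ⟨θ, hθ, hgθ⟩ := ih.1 hg
      refine ⟨fun x => (continuousMultilinearCurryRightEquiv' ℝ m E F).symm (θ x),
        ContDiff.comp (g := (continuousMultilinearCurryRightEquiv' ℝ m E F).symm)
          (LinearIsometryEquiv.contDiff _) hθ, fun x => ?_⟩
      rw [hfg, hgθ]
      rfl
    · rintro ⟨θ, hθ, hfθ⟩
      refine ⟨fun x => continuousMultilinearCurryRightEquiv' ℝ m E F (θ x) (fun _ => x),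
        ih.2 ⟨_, (continuousMultilinearCurryRightEquiv' ℝ m E F).contDiff.comp hθ,
          fun x => rfl⟩, fun x => ?_⟩
      rw [hfθ, continuousMultilinearCurryRightEquiv_apply']
      congr 1
      ext i
      refine Fin.lastCases ?_ (fun j => ?_) i <;> simp

theorem VanishesToOrder.exists_symmetric {m : ℕ} {f : E → F} (hf : VanishesToOrder m f) :
    ∃ θ : E → ContinuousMultilinearMap ℝ (fun _ : Fin m => E) F,
      ContDiff ℝ (⊤ : ℕ∞) θ ∧
      (∀ x, ∀ v : Fin m → E, ∀ σ : Equiv.Perm (Fin m), θ x (v ∘ σ) = θ x v) ∧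
      ∀ x, f x = θ x (fun _ => x) := by
  obtain ⟨θ, hθ, hfθ⟩ := vanishesToOrder_iff_exists_multilinear.1 hf
  let D : Equiv.Perm (Fin m) → _ := fun σ =>
    ContinuousMultilinearMap.domDomCongrₗᵢ ℝ E F σ
  have hD : ∀ σ x v, D σ (θ x) v = θ x (v ∘ σ) := fun σ x v => rfl
  refine ⟨fun x => (m.factorial : ℝ)⁻¹ • ∑ σ, D σ (θ x),
    ContDiff.const_smul _ (ContDiff.sum fun σ _ => (D σ).contDiff.comp hθ),
    fun x v σ => ?_, fun x => ?_⟩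
  · simp only [_root_.smul_apply, _root_.sum_apply, hD]
    congr 1
    exact Fintype.sum_equiv (Equiv.mulLeft σ) _ _ fun τ => rfl
  · simp only [_root_.smul_apply, _root_.sum_apply, hD]
    have hm : (m.factorial : ℝ) ≠ 0 := by exact_mod_cast m.factorial_ne_zero
    have hc : ∀ σ : Equiv.Perm (Fin m), θ x ((fun _ => x) ∘ σ) = f x := fun σ => (hfθ x).symm
    simp only [hc]
    rw [Finset.sum_const, Finset.card_univ, Fintype.card_perm, Fintype.card_fin,
      ← Nat.cast_smul_eq_nsmul ℝ, smul_smul, inv_mul_cancel₀ hm, one_smul]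

end VanishesToOrder

theorem eqMod_iff_vanishesToOrder {p m : ℕ} {φ ψ : Euc p → Euc p} :
    EqMod m φ ψ ↔ VanishesToOrder m (fun x => φ x - ψ x) := by
  constructor
  · rintro ⟨θ, hθ, -, h⟩
    exact vanishesToOrder_iff_exists_multilinear.2 ⟨θ, hθ, fun x => by rw [h x]; abel⟩
  · intro h
    obtain ⟨θ, hθ, hs, hx⟩ := h.exists_symmetric
    exact ⟨θ, hθ, hs, fun x => by rw [← hx x]; abel⟩

/-- If `φ ≡₁ 0`, `φ ≡₃ φ̃` and `ψ ≡₂ ψ̃`, then `[φ,ψ] ≡₂ [φ̃,ψ̃]`. -/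
theorem statement10
    (p : ℕ) (hp : 0 < p)
    (φ φt ψ ψt : Euc p → Euc p)
    (hφ : ContDiff ℝ (⊤ : ℕ∞) φ) (hφt : ContDiff ℝ (⊤ : ℕ∞) φt)
    (hψ : ContDiff ℝ (⊤ : ℕ∞) ψ) (hψt : ContDiff ℝ (⊤ : ℕ∞) ψt)
    (h1 : EqMod 1 φ (fun _ => 0))
    (h3 : EqMod 3 φ φt)
    (h2 : EqMod 2 ψ ψt) :
    EqMod 2 (lieB φ ψ) (lieB φt ψt) := by
  rw [eqMod_iff_vanishesToOrder] at h1 h2 h3 ⊢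
  simp only [sub_zero] at h1
  have hφt1 : VanishesToOrder 1 φt := by
    simpa using h1.sub h3.of_succ.of_succ
  have hdiff : ∀ {f : Euc p → Euc p}, ContDiff ℝ (⊤ : ℕ∞) f → Differentiable ℝ f :=
    fun hf => hf.differentiable (by simp)
  have e₁ := (vanishesToOrder_zero.2 hψ.contDiff_fderiv_infty).clm_apply h3
  have e₂ := h2.fderiv.clm_apply hφt1
  have e₃ := h3.fderiv.clm_apply (vanishesToOrder_zero.2 hψ)
  have e₄ := (vanishesToOrder_zero.2 hφt.contDiff_fderiv_infty).clm_apply h2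
  rw [zero_add] at e₁ e₄
  have key := ((e₁.of_succ.add e₂).sub e₃).sub e₄
  convert key using 2 with x
  rw [fderiv_fun_sub (hdiff hψ x) (hdiff hψt x), fderiv_fun_sub (hdiff hφ x) (hdiff hφt x)]
  simp only [lieB, _root_.sub_apply, map_sub]
  abel
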